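/- arXiv:1103.6114 — 2 statements merged into one kernel-verified Lean document; each statement's English description precedes it below -/
import Mathlib

section
/- Let Γ_1, Γ_2 be i.i.d. random variables on ℕ with Pr[Γ = 2] = 2/3 and Pr[Γ = γ + 2] = 2^{-γ}/3 for every integer γ ≥ 1 (the Weak Ordering critical-window distribution, window length = gap + 2), and let s_1, s_2 be i.i.d. random variables on ℕ with Pr[s_i = k] = 2^{-(k+1)}, independent of Γ_1, Γ_2. Then the probability that the random intervals [s_1, s_1 + Γ_1] and [s_2, s_2 + Γ_2] are disjoint equals exactly 7/54. -/
open scoped Classical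

/-- The Weak Ordering critical-window-length distribution:
`Pr[Γ = 2] = 2/3` and `Pr[Γ = γ + 2] = 2^{-γ}/3` for every integer `γ ≥ 1`
(window length = gap + 2). -/
noncomputable def woPMF (g : ℕ) : ℝ :=
  if g = 2 then 2 / 3 else if 3 ≤ g then (2:ℝ)⁻¹ ^ (g - 2) / 3 else 0

lemma woPMF_nonneg (g : ℕ) : 0 ≤ woPMF g := by
  unfold woPMF
  split_ifs <;> positivity

lemma hasSum_mul_pow_woPMF {r : ℝ} (h₀ : 0 ≤ r) (h₁ : r ≤ 1) :
    HasSum (fun g => woPMF g * r ^ g) (r ^ 2 * (2 / 3 + r / 6 * (1 - r / 2)⁻¹)) := by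
  have hg : HasSum (fun n : ℕ => r ^ 3 / 6 * (r / 2) ^ n) (r ^ 3 / 6 * (1 - r / 2)⁻¹) :=
    (hasSum_geometric_of_lt_one (by linarith) (by linarith)).mul_left _
  have hs : (fun n => woPMF (n + 3) * r ^ (n + 3)) = fun n : ℕ => r ^ 3 / 6 * (r / 2) ^ n := by
    funext n
    have h : n + 3 - 2 = n + 1 := by omega
    simp only [woPMF, h, Nat.le_add_left, if_true, show n + 3 ≠ 2 by omega, if_false]
    rw [div_eq_mul_inv r 2, mul_pow]
    ring
  rw [← hs] at hg
  have h := (hasSum_nat_add_iff (f := fun g => woPMF g * r ^ g) 3).1 hg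
  have hval : r ^ 3 / 6 * (1 - r / 2)⁻¹ + ∑ g ∈ Finset.range 3, woPMF g * r ^ g =
      r ^ 2 * (2 / 3 + r / 6 * (1 - r / 2)⁻¹) := by
    simp [Finset.sum_range_succ, woPMF]
    ring
  rwa [hval] at h

lemma HasSum.mul_prod_of_nonneg {α β : Type*} {f : α → ℝ} {g : β → ℝ} {a b : ℝ}
    (hf : HasSum f a) (hg : HasSum g b) (hf₀ : ∀ x, 0 ≤ f x) (hg₀ : ∀ y, 0 ≤ g y) :
    HasSum (fun x : α × β => f x.1 * g x.2) (a * b) :=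
  hf.mul hg (hf.summable.mul_of_nonneg hg.summable hf₀ hg₀)

/-- The joint mass function of two window lengths and two geometric shifts. -/
noncomputable def jointPMF (x : (ℕ × ℕ) × ℕ × ℕ) : ℝ :=
  woPMF x.1.1 * woPMF x.1.2 * (2:ℝ)⁻¹ ^ (x.2.1 + 1) * (2:ℝ)⁻¹ ^ (x.2.2 + 1)

lemma hasSum_jointPMF_fst_before_snd :
    HasSum (fun x => if x.2.1 + x.1.1 < x.2.2 then jointPMF x else 0) (7 / 108) := by
  let e : (ℕ × ℕ) × ℕ × ℕ → (ℕ × ℕ) × ℕ × ℕ :=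
    fun x => (x.1, x.2.1, x.2.1 + x.1.1 + 1 + x.2.2)
  have he : Function.Injective e := by
    rintro ⟨⟨a, b⟩, s, k⟩ ⟨⟨a₂, b₂⟩, s₂, k₂⟩ h
    simp only [e, Prod.mk.injEq] at h ⊢
    omega
  rw [← he.hasSum_iff]
  · have hfst := hasSum_mul_pow_woPMF (r := 2⁻¹) (by norm_num) (by norm_num)
    have hsnd := hasSum_mul_pow_woPMF (r := 1) (by norm_num) (by norm_num)
    have hs := (hasSum_geometric_of_lt_one (r := (4:ℝ)⁻¹) (by norm_num) (by norm_num)).mul_left 8⁻¹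
    have hk := hasSum_geometric_of_lt_one (r := (2:ℝ)⁻¹) (by norm_num) (by norm_num)
    have hΓ := hfst.mul_prod_of_nonneg hsnd
      (fun g => mul_nonneg (woPMF_nonneg g) (by positivity))
      (fun g => mul_nonneg (woPMF_nonneg g) (by positivity))
    have hsk := hs.mul_prod_of_nonneg hk (fun _ => by positivity) (fun _ => by positivity)
    convert hΓ.mul_prod_of_nonneg hsk
      (fun g => mul_nonneg (mul_nonneg (woPMF_nonneg _) (by positivity))
        (mul_nonneg (woPMF_nonneg _) (by positivity)))
      (fun _ => by positivity) using 1
    · funext ⟨⟨a, b⟩, s, k⟩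
      have h : s + a < s + a + 1 + k := by omega
      simp only [Function.comp, e, jointPMF, h, if_true]
      rw [show (4:ℝ)⁻¹ = 2⁻¹ * 2⁻¹ by norm_num, mul_pow]
      ring
    · norm_num
  · rintro ⟨⟨a, b⟩, s, t⟩ hx
    refine if_neg fun h => hx ⟨((a, b), s, t - (s + a + 1)), ?_⟩
    simp only [e, Prod.mk.injEq, true_and] at h ⊢
    omega

lemma hasSum_jointPMF_snd_before_fst :
    HasSum (fun x => if x.2.2 + x.1.2 < x.2.1 then jointPMF x else 0) (7 / 108) := by
  rw [← ((Equiv.prodComm ℕ ℕ).prodCongr (Equiv.prodComm ℕ ℕ)).hasSum_iff]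
  convert hasSum_jointPMF_fst_before_snd using 1
  funext ⟨⟨a, b⟩, s, t⟩
  simp only [Function.comp, Equiv.prodCongr_apply, Prod.map, Equiv.prodComm_apply, Prod.swap,
    jointPMF]
  congr 1
  ring

lemma disjoint_Icc_add_iff (s t a b : ℕ) :
    Disjoint (Finset.Icc s (s + a)) (Finset.Icc t (t + b)) ↔ s + a < t ∨ t + b < s := by
  simp only [Finset.disjoint_left, Finset.mem_Icc]
  refine ⟨fun h => ?_, fun h x hx hy => by omega⟩
  have := @h (max s t)
  omega

/-- Let `Γ₁, Γ₂` be i.i.d. with the Weak Ordering critical-window distribution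
`woPMF`, and let `s₁, s₂` be i.i.d. with `Pr[sᵢ = k] = 2^{-(k+1)}`, independent
of `Γ₁, Γ₂`.  Then the probability that the random intervals `[s₁, s₁ + Γ₁]`
and `[s₂, s₂ + Γ₂]` are disjoint equals exactly `7/54`.  (Independence is
modeled by the product joint mass function, summed over all outcomes
`x = ((Γ₁, Γ₂), (s₁, s₂))`.) -/
theorem weak_ordering_two_threads_prob :
    (∑' x : (ℕ × ℕ) × ℕ × ℕ,
        if Disjoint (Finset.Icc x.2.1 (x.2.1 + x.1.1))
            (Finset.Icc x.2.2 (x.2.2 + x.1.2)) then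
          woPMF x.1.1 * woPMF x.1.2 * (2:ℝ)⁻¹ ^ (x.2.1 + 1) * (2:ℝ)⁻¹ ^ (x.2.2 + 1)
        else 0) = 7 / 54 := by
  refine HasSum.tsum_eq ?_
  convert hasSum_jointPMF_fst_before_snd.add hasSum_jointPMF_snd_before_fst using 1
  · funext ⟨⟨a, b⟩, s, t⟩
    simp only [disjoint_Icc_add_iff, jointPMF]
    by_cases h₁ : s + a < t
    · have h₂ : ¬ t + b < s := by omega
      simp [h₁, h₂]
    · simp [h₁]
  · norm_num
end

section
/- Let n ≥ 1 and let Γ = (Γ_1, …, Γ_n) be a random vector of nonnegative integer segment lengths whose joint distribution is exchangeable (invariant under every permutation of coordinates), independent of the shifts. Then the probability that all shifted segments are pairwise disjoint equals Pr[A(Γ)] = c(n) · 2^{-C(n+1,2)} · n! · E[∏_{i=1}^{n-1} 2^{-i·Γ_i}], where c(n) = 2 / ∏_{i=1}^{n-1} (1 - 2^{-(n+1-i)}). -/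
open scoped Classical

/-- The event, for the shift process, that the shifted closed integer segments
`[s i, s i + γ i]` are pairwise disjoint. -/
def shiftDisjoint {n : ℕ} (γ s : Fin n → ℕ) : Prop :=
  ∀ i j : Fin n, i ≠ j →
    Disjoint (Finset.Icc (s i) (s i + γ i)) (Finset.Icc (s j) (s j + γ j))

/-- `prA γ` is the probability, under i.i.d. geometric(1/2) shifts
(`Pr[sᵢ = k] = 2^{-(k+1)}`), that all shifted segments `[sᵢ, sᵢ + γᵢ]`
are pairwise disjoint. -/
noncomputable def prA {n : ℕ} (γ : Fin n → ℕ) : ℝ :=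
  ∑' s : Fin n → ℕ,
    if shiftDisjoint γ s then ∏ i : Fin n, ((2:ℝ)⁻¹) ^ (s i + 1) else 0


/-- The constant `c(n) = 2 / ∏_{i=1}^{n-1} (1 - 2^{-(n+1-i)})`
(written via `j = n+1-i` as `2 / ∏_{j=2}^{n} (1 - 2^{-j})`). -/
noncomputable def cshift (n : ℕ) : ℝ :=
  2 / ∏ j ∈ Finset.Icc 2 n, (1 - (2:ℝ)⁻¹ ^ j)

/-- The segments `[s i, s i + γ i]` are disjoint and listed from right to left. -/
def shiftDecreasing {n : ℕ} (γ s : Fin n → ℕ) : Prop :=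
  ∀ i j : Fin n, i < j → s j + γ j < s i

/-- The probability that the shifted segments are disjoint and listed from right to left. -/
noncomputable def decreasingProb {n : ℕ} (γ : Fin n → ℕ) : ℝ :=
  ∏ i : Fin n, (2:ℝ)⁻¹ ^ ((i : ℕ) * (γ i + 1) + 1) / (1 - (2:ℝ)⁻¹ ^ ((i : ℕ) + 1))

theorem shiftDecreasing_snoc_iff {n : ℕ} (γ : Fin (n + 1) → ℕ) (s : Fin n → ℕ) (m : ℕ) :
    shiftDecreasing γ (Fin.snoc (fun i => s i + (m + γ (Fin.last n) + 1)) m : Fin (n + 1) → ℕ) ↔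
      shiftDecreasing (fun i => γ (Fin.castSucc i)) s := by
  constructor
  · intro h i j hij
    have := h i.castSucc j.castSucc (by simpa using hij)
    simp only [Fin.snoc_castSucc] at this
    dsimp only
    omega
  · intro h i j hij
    induction i using Fin.lastCases with
    | last => exact absurd hij (not_lt.2 (Fin.le_last j))
    | cast i =>
      induction j using Fin.lastCases with
      | last => simp only [Fin.snoc_castSucc, Fin.snoc_last]; omega
      | cast j =>
        have := h i j (by simpa using hij)
        simp only [Fin.snoc_castSucc]
        dsimp only at this
        omega

theorem hasSum_shiftDecreasing {n : ℕ} (γ : Fin n → ℕ) :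
    HasSum (fun s : Fin n → ℕ =>
      if shiftDecreasing γ s then ∏ i : Fin n, ((2:ℝ)⁻¹) ^ (s i + 1) else 0)
      (decreasingProb γ) := by
  induction n with
  | zero =>
    convert hasSum_unique (fun s : Fin 0 → ℕ =>
      if shiftDecreasing γ s then ∏ i : Fin 0, ((2:ℝ)⁻¹) ^ (s i + 1) else 0) using 1
    have h : ∀ s, shiftDecreasing γ s := fun _ i => i.elim0
    simp [decreasingProb, h]
  | succ n ih =>
    let g : ℕ × (Fin n → ℕ) → (Fin (n + 1) → ℕ) := fun p =>
      Fin.snoc (fun i => p.2 i + (p.1 + γ (Fin.last n) + 1)) p.1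
    have hg : Function.Injective g := by
      rintro ⟨m, s⟩ ⟨m', s'⟩ h
      have hm : m = m' := by simpa [g] using congrFun h (Fin.last n)
      subst hm
      have hs : s = s' := by
        funext i
        simpa [g] using congrFun h i.castSucc
      rw [hs]
    rw [← hg.hasSum_iff]
    · have hgeom : HasSum (fun m : ℕ => (2:ℝ)⁻¹ ^ (n * (γ (Fin.last n) + 1) + 1) *
          ((2:ℝ)⁻¹ ^ (n + 1)) ^ m)
          ((2:ℝ)⁻¹ ^ (n * (γ (Fin.last n) + 1) + 1) * (1 - (2:ℝ)⁻¹ ^ (n + 1))⁻¹) :=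
        (hasSum_geometric_of_lt_one (by positivity)
          (pow_lt_one₀ (by norm_num) (by norm_num) (Nat.succ_ne_zero n))).mul_left _
      have hprod := hgeom.mul (ih fun i => γ i.castSucc)
        (hgeom.summable.mul_of_nonneg (ih fun i => γ i.castSucc).summable
          (fun m => by positivity) (fun s => by dsimp only; split_ifs <;> positivity))
      have hval : decreasingProb γ = (2:ℝ)⁻¹ ^ (n * (γ (Fin.last n) + 1) + 1) *
          (1 - (2:ℝ)⁻¹ ^ (n + 1))⁻¹ * decreasingProb fun i => γ i.castSucc := by
        rw [decreasingProb, Fin.prod_univ_castSucc, mul_comm]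
        simp [decreasingProb, div_eq_mul_inv]
      rw [hval]
      refine (congrArg (HasSum · _) (funext fun p => ?_)).mpr hprod
      obtain ⟨m, s⟩ := p
      simp only [Function.comp, g, shiftDecreasing_snoc_iff]
      split_ifs
      · rw [Fin.prod_univ_castSucc]
        simp only [Fin.snoc_castSucc, Fin.snoc_last]
        simp only [pow_add _ (_ + _) _, pow_add _ (s _) _, Finset.prod_mul_distrib,
          Finset.prod_const, Finset.card_univ, Fintype.card_fin]
        ring
      · simp
    · intro s hs
      rw [if_neg]
      intro h
      refine hs ⟨(s (Fin.last n),
        fun i => s i.castSucc - (s (Fin.last n) + γ (Fin.last n) + 1)), ?_⟩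
      funext i
      induction i using Fin.lastCases with
      | last => simp [g]
      | cast i =>
        have := h i.castSucc (Fin.last n) (Fin.castSucc_lt_last i)
        simp only [g, Fin.snoc_castSucc]
        omega

theorem shiftDecreasing.strictAnti {n : ℕ} {γ s : Fin n → ℕ} (h : shiftDecreasing γ s) :
    StrictAnti s := fun i j hij => by have := h i j hij; omega

theorem shiftDecreasing.shiftDisjoint {n : ℕ} {γ s : Fin n → ℕ} {σ : Equiv.Perm (Fin n)}
    (h : shiftDecreasing (γ ∘ σ) (s ∘ σ)) : shiftDisjoint γ s := by
  intro i j hij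
  rw [Finset.disjoint_left]
  intro a hi hj
  rw [Finset.mem_Icc] at hi hj
  rcases lt_or_gt_of_ne (fun e => hij (σ.symm.injective e)) with hlt | hlt
  · have := h _ _ hlt
    simp only [Function.comp, Equiv.apply_symm_apply] at this
    omega
  · have := h _ _ hlt
    simp only [Function.comp, Equiv.apply_symm_apply] at this
    omega

theorem shiftDisjoint.exists_shiftDecreasing {n : ℕ} {γ s : Fin n → ℕ}
    (h : shiftDisjoint γ s) :
    ∃ σ : Equiv.Perm (Fin n), shiftDecreasing (γ ∘ σ) (s ∘ σ) := by
  refine ⟨Tuple.sort (OrderDual.toDual ∘ s), fun i j hij => ?_⟩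
  have hle : s (Tuple.sort (OrderDual.toDual ∘ s) j) ≤ s (Tuple.sort (OrderDual.toDual ∘ s) i) :=
    Tuple.monotone_sort (OrderDual.toDual ∘ s) hij.le
  have hd := h _ _ ((Tuple.sort (OrderDual.toDual ∘ s)).injective.ne hij.ne)
  by_contra hlt
  simp only [Function.comp, not_lt] at hlt
  exact Finset.disjoint_left.1 hd
    (Finset.mem_Icc.2 ⟨le_rfl, Nat.le_add_right _ _⟩) (Finset.mem_Icc.2 ⟨hle, hlt⟩)

theorem shiftDecreasing.perm_unique {n : ℕ} {γ s : Fin n → ℕ} {σ τ : Equiv.Perm (Fin n)}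
    (hσ : shiftDecreasing (γ ∘ σ) (s ∘ σ)) (hτ : shiftDecreasing (γ ∘ τ) (s ∘ τ)) : σ = τ := by
  have hs : Function.Injective s := by
    intro a b hab
    have := hσ.strictAnti.injective (a₁ := σ.symm a) (a₂ := σ.symm b) (by simpa using hab)
    simpa using this
  have h := Tuple.unique_monotone (f := OrderDual.toDual ∘ s) (σ := σ) (τ := τ)
    (fun i j hij => hσ.strictAnti.antitone hij) (fun i j hij => hτ.strictAnti.antitone hij)
  ext1 i
  exact hs (congrFun h i)

theorem ite_shiftDisjoint_eq_sum {n : ℕ} (γ s : Fin n → ℕ) (x : ℝ) :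
    (if shiftDisjoint γ s then x else 0) =
      ∑ σ : Equiv.Perm (Fin n), if shiftDecreasing (γ ∘ σ) (s ∘ σ) then x else 0 := by
  split_ifs with h
  · obtain ⟨σ, hσ⟩ := h.exists_shiftDecreasing
    rw [Finset.sum_eq_single σ (fun τ _ hτ => if_neg fun h' => hτ (h'.perm_unique hσ))
      (by simp), if_pos hσ]
  · exact (Finset.sum_eq_zero fun σ _ => if_neg fun h' => h h'.shiftDisjoint).symm

theorem prA_eq_sum_perm {n : ℕ} (γ : Fin n → ℕ) :
    prA γ = ∑ σ : Equiv.Perm (Fin n), decreasingProb (γ ∘ σ) := by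
  refine HasSum.tsum_eq ?_
  simp only [ite_shiftDisjoint_eq_sum]
  refine hasSum_sum fun σ _ => ?_
  convert (σ.symm.arrowCongr (Equiv.refl ℕ)).hasSum_iff.2 (hasSum_shiftDecreasing (γ ∘ σ))
    using 1
  funext s
  change _ = if shiftDecreasing (γ ∘ σ) (s ∘ σ) then
    ∏ i : Fin n, ((2:ℝ)⁻¹) ^ (s (σ i) + 1) else 0
  rw [Equiv.prod_comp σ fun i => ((2:ℝ)⁻¹) ^ (s i + 1)]

theorem decreasingProb_eq {n : ℕ} (hn : 1 ≤ n) (γ : Fin n → ℕ) :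
    decreasingProb γ = cshift n * (2:ℝ)⁻¹ ^ (Nat.choose (n + 1) 2) *
      ∏ i : Fin n, (2:ℝ)⁻¹ ^ ((i : ℕ) * γ i) := by
  have hden : ∏ i : Fin n, (1 - (2:ℝ)⁻¹ ^ ((i : ℕ) + 1)) =
      2⁻¹ * ∏ j ∈ Finset.Icc 2 n, (1 - (2:ℝ)⁻¹ ^ j) := by
    rw [Fin.prod_univ_eq_prod_range (fun i => 1 - (2:ℝ)⁻¹ ^ (i + 1)) n]
    induction n, hn using Nat.le_induction with
    | base => norm_num
    | succ n hn ih =>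
      rw [Finset.prod_range_succ, ih (fun _ => 0), Finset.prod_Icc_succ_top (by omega)]
      ring
  have hpow : ∏ i : Fin n, (2:ℝ)⁻¹ ^ ((i : ℕ) + 1) = (2:ℝ)⁻¹ ^ (Nat.choose (n + 1) 2) := by
    rw [Finset.prod_pow_eq_pow_sum, Fin.sum_univ_eq_sum_range (fun i => i + 1) n]
    congr 1
    have := Finset.sum_range_id_mul_two (n + 1)
    rw [Finset.sum_range_succ'] at this
    rw [Nat.choose_two_right]
    omega
  rw [decreasingProb, Finset.prod_div_distrib, hden, cshift, ← hpow]
  have hnum : ∏ i : Fin n, (2:ℝ)⁻¹ ^ ((i : ℕ) * (γ i + 1) + 1) =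
      (∏ i : Fin n, (2:ℝ)⁻¹ ^ ((i : ℕ) + 1)) * ∏ i : Fin n, (2:ℝ)⁻¹ ^ ((i : ℕ) * γ i) := by
    rw [← Finset.prod_mul_distrib]
    exact Finset.prod_congr rfl fun i _ => by rw [← pow_add]; congr 1; ring
  rw [hnum, div_eq_mul_inv, mul_inv, div_eq_mul_inv, inv_inv]
  ring

theorem tsum_mul_comp_perm {n : ℕ} {w : (Fin n → ℕ) → ℝ}
    (hexch : ∀ σ : Equiv.Perm (Fin n), ∀ γ : Fin n → ℕ, w (γ ∘ σ) = w γ)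
    (f : (Fin n → ℕ) → ℝ) (σ : Equiv.Perm (Fin n)) :
    ∑' γ : Fin n → ℕ, w γ * f (γ ∘ σ) = ∑' γ : Fin n → ℕ, w γ * f γ := by
  rw [← (σ.symm.arrowCongr (Equiv.refl ℕ)).tsum_eq fun γ => w γ * f γ]
  refine tsum_congr fun γ => ?_
  change _ = w (γ ∘ σ) * f (γ ∘ σ)
  rw [hexch]

theorem prod_pow_comp_finRotate_symm {n : ℕ} (hn : 1 ≤ n) (γ : Fin n → ℕ) :
    ∏ i : Fin n, (2:ℝ)⁻¹ ^ ((i : ℕ) * (γ ∘ (finRotate n).symm) i) =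
      ∏ j : Fin (n - 1),
        (2:ℝ)⁻¹ ^ (((j : ℕ) + 1) * γ (Fin.castLE (Nat.sub_le n 1) j)) := by
  obtain ⟨m, rfl⟩ := Nat.exists_eq_add_of_le' hn
  rw [Fin.prod_univ_succ]
  simp only [Fin.val_zero, zero_mul, pow_zero, one_mul]
  refine Finset.prod_congr rfl fun j _ => ?_
  have : (finRotate (m + 1)).symm j.succ = j.castSucc := by
    rw [Equiv.symm_apply_eq, finRotate_apply, Fin.coeSucc_eq_succ]
  rw [Function.comp, this]
  rfl

/-- Let `n ≥ 1` and let `Γ` be a random vector of nonnegative integer segment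
lengths, given by a joint mass function `w` (nonnegative, summing to 1) that is
exchangeable, independent of the shifts.  Then the probability that all
shifted segments are pairwise disjoint equals
`Pr[A(Γ)] = c(n) · 2^{-C(n+1,2)} · n! · E[∏_{i=1}^{n-1} 2^{-i·Γ_i}]`.
(The product `∏_{i=1}^{n-1} 2^{-i·Γ_i}` is written 0-based: `j : Fin (n-1)`
corresponds to `i = j+1`, and `Γ_i` is coordinate `j` of `γ`.) -/
theorem shift_process_exchangeable_lengths {n : ℕ} (hn : 1 ≤ n)
    (w : (Fin n → ℕ) → ℝ) (hw0 : ∀ γ, 0 ≤ w γ) (hw1 : HasSum w 1)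
    (hexch : ∀ σ : Equiv.Perm (Fin n), ∀ γ : Fin n → ℕ, w (γ ∘ σ) = w γ) :
    ∑' γ : Fin n → ℕ, w γ * prA γ =
      cshift n * (2:ℝ)⁻¹ ^ (Nat.choose (n + 1) 2) * (Nat.factorial n) *
        ∑' γ : Fin n → ℕ,
          w γ * ∏ j : Fin (n - 1),
            (2:ℝ)⁻¹ ^ (((j : ℕ) + 1) * γ (Fin.castLE (Nat.sub_le n 1) j)) := by
  have hint : ∀ σ : Equiv.Perm (Fin n),
      Summable fun γ : Fin n → ℕ => w γ * decreasingProb (γ ∘ σ) := by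
    intro σ
    simp only [decreasingProb_eq hn, mul_left_comm (w _)]
    refine Summable.mul_left _ (hw1.summable.of_nonneg_of_le
      (fun γ => mul_nonneg (hw0 γ) (by positivity)) fun γ => ?_)
    refine mul_le_of_le_one_right (hw0 γ) (Finset.prod_le_one (fun i _ => by positivity)
      fun i _ => pow_le_one₀ (by norm_num) (by norm_num))
  simp only [prA_eq_sum_perm, Finset.mul_sum]
  rw [Summable.tsum_finsetSum fun σ _ => hint σ]
  have hperm : ∀ σ : Equiv.Perm (Fin n), ∑' γ : Fin n → ℕ, w γ * decreasingProb (γ ∘ σ) =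
      ∑' γ : Fin n → ℕ, w γ * decreasingProb (γ ∘ (finRotate n).symm) := fun σ => by
    rw [tsum_mul_comp_perm hexch, tsum_mul_comp_perm hexch]
  rw [Finset.sum_congr rfl fun σ _ => hperm σ, Finset.sum_const, Finset.card_univ,
    Fintype.card_perm, Fintype.card_fin, nsmul_eq_mul]
  simp only [decreasingProb_eq hn, prod_pow_comp_finRotate_symm hn, mul_left_comm (w _),
    tsum_mul_left]
  ring
end
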